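/- Let n be a real constant with n ≠ 0, let x : ℝ → ℝ be twice differentiable and strictly positive on an open interval I, let φ : I → ℝ be differentiable, and let F : I → ℝ be differentiable with F' = φ on I. Define U(t) = x(t)^n · exp(F(t)). Then x satisfies x'' + (n−1)·(x')²/x + 2·x'·φ + (x/n)·φ' + (x/n)·φ² = 0 on I if and only if U'' = 0 on I. -/

import Mathlib

/-- The derivative of `x ^ n * exp F` in logarithmic form. -/
theorem hasDerivAt_rpow_mul_exp {n x' F' t : ℝ} {x F : ℝ → ℝ} (hx : HasDerivAt x x' t)
    (hF : HasDerivAt F F' t) (hpos : 0 < x t) :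
    HasDerivAt (fun s => x s ^ n * Real.exp (F s))
      (x t ^ n * Real.exp (F t) * (n * x' / x t + F')) t := by
  have h := (hx.rpow_const (p := n) (Or.inl hpos.ne')).mul hF.exp
  refine h.congr_deriv ?_
  rw [Real.rpow_sub_one hpos.ne']
  field_simp

/-- With `U(t) = x(t)ⁿ·exp(F(t))` where `F' = φ` on the interval (the
nonlocal transformation `U = xⁿ e^{∫φ dt}`, `φ(t) = f(x(t),y(t))`), a positive twice
differentiable `x` satisfies `x'' + (n−1)(x')²/x + 2x'φ + (x/n)φ' + (x/n)φ² = 0` on an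
open interval iff `U'' = 0` there. -/
theorem stmt_19 (n : ℝ) (hn : n ≠ 0) (a b : ℝ) (x φ F : ℝ → ℝ)
    (hx : ∀ t ∈ Set.Ioo a b, DifferentiableAt ℝ x t)
    (hx' : ∀ t ∈ Set.Ioo a b, DifferentiableAt ℝ (deriv x) t)
    (hpos : ∀ t ∈ Set.Ioo a b, 0 < x t)
    (hφ : ∀ t ∈ Set.Ioo a b, DifferentiableAt ℝ φ t)
    (hF : ∀ t ∈ Set.Ioo a b, HasDerivAt F (φ t) t)
    (U : ℝ → ℝ) (hU : U = fun t => x t ^ n * Real.exp (F t)) :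
    (∀ t ∈ Set.Ioo a b,
        deriv (deriv x) t + (n - 1) * (deriv x t) ^ 2 / x t + 2 * deriv x t * φ t
          + (x t / n) * deriv φ t + (x t / n) * (φ t) ^ 2 = 0) ↔
    (∀ t ∈ Set.Ioo a b, deriv (deriv U) t = 0) := by
  subst hU
  refine forall₂_congr fun t ht => ?_
  have hU' : ∀ s ∈ Set.Ioo a b, HasDerivAt (fun s => x s ^ n * Real.exp (F s))
      (x s ^ n * Real.exp (F s) * (n * deriv x s / x s + φ s)) s := fun s hs =>
    hasDerivAt_rpow_mul_exp (hx s hs).hasDerivAt (hF s hs) (hpos s hs)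
  have hxt : x t ≠ 0 := (hpos t ht).ne'
  have hlog : HasDerivAt (fun s => n * deriv x s / x s + φ s)
      ((n * deriv (deriv x) t * x t - n * deriv x t * deriv x t) / x t ^ 2 + deriv φ t) t :=
    (((hx' t ht).hasDerivAt.const_mul n).div (hx t ht).hasDerivAt hxt).add (hφ t ht).hasDerivAt
  have hderiv : deriv (fun s => x s ^ n * Real.exp (F s)) =ᶠ[nhds t]
      fun s => x s ^ n * Real.exp (F s) * (n * deriv x s / x s + φ s) := by
    filter_upwards [isOpen_Ioo.mem_nhds ht] with s hs using (hU' s hs).deriv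
  have hfactor : deriv (deriv fun s => x s ^ n * Real.exp (F s)) t =
      x t ^ n * Real.exp (F t) * (n / x t) *
        (deriv (deriv x) t + (n - 1) * (deriv x t) ^ 2 / x t + 2 * deriv x t * φ t
          + (x t / n) * deriv φ t + (x t / n) * (φ t) ^ 2) := by
    rw [hderiv.deriv_eq, ((hU' t ht).fun_mul hlog).deriv]
    field_simp
    ring
  have hne : x t ^ n * Real.exp (F t) * (n / x t) ≠ 0 :=
    mul_ne_zero (mul_ne_zero (Real.rpow_pos_of_pos (hpos t ht) n).ne' (Real.exp_ne_zero _))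
      (div_ne_zero hn hxt)
  rw [hfactor, mul_eq_zero_iff_left hne]
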